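/- Consider the second-order product of the specific channel and metric given below, and the superposition-coding input distribution Q_{UX} built from Q = (0.749, 0.251) as specified. With ρ₁ = 0.7587516, s = 9.3419338, R₁ = 0.2403966, and a : U × X² → ℝ given by a(0,(0,0)) = 0.7186926, a(0,(0,1)) = a(0,(1,0)) = −0.0488036, a(0,(1,1)) = 0, a(1,(0,0)) = a(1,(0,1)) = a(1,(1,0)) = 0, a(1,(1,1)) = −0.6210855, the dual superposition-coding R₀ objective satisfies Σ_{u,x,y} Q_U(u) Q_{X|U}(x|u) W²(y|x) log( ( q²(x,y)^s e^{a(u,x)} )^{ρ₁} / Σ_{ū} Q_U(ū) ( Σ_{x̄} Q_{X|U}(x̄|ū) q²(x̄,y)^s e^{a(ū,x̄)} )^{ρ₁} ) − ρ₁ R₁ ≥ 0.0356005. -/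

import Mathlib

open scoped BigOperators

/-- The channel `W(y|x)` of the counter-example. -/
noncomputable def W : Fin 2 → Fin 3 → ℝ := ![![0.97, 0.03, 0], ![0.1, 0.1, 0.8]]

/-- The decoding metric `q(x,y)` of the counter-example. -/
noncomputable def q : Fin 2 → Fin 3 → ℝ := ![![1, 1, 1], ![1, 0.5, 1.36]]

/-- The second-order product channel `W²((y₁,y₂)|(x₁,x₂))`. -/
noncomputable def W2 (x : Fin 2 × Fin 2) (y : Fin 3 × Fin 3) : ℝ := W x.1 y.1 * W x.2 y.2

/-- The second-order product metric `q²((x₁,x₂),(y₁,y₂))`. -/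
noncomputable def q2 (x : Fin 2 × Fin 2) (y : Fin 3 × Fin 3) : ℝ := q x.1 y.1 * q x.2 y.2

/-- The auxiliary distribution `Q_U` built from `Q = (0.749, 0.251)`. -/
noncomputable def QU : Fin 2 → ℝ := ![1 - (0.251 : ℝ) ^ 2, (0.251 : ℝ) ^ 2]

/-- The conditional input distribution `Q_{X|U}` built from `Q = (0.749, 0.251)`:
`Q_{X|U}(·|0) = (Q₀², Q₀Q₁, Q₀Q₁, 0)/(1 − Q₁²)` and `Q_{X|U}(·|1) = (0,0,0,1)`,
inputs ordered `(0,0), (0,1), (1,0), (1,1)`. -/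
noncomputable def QXU : Fin 2 → Fin 2 × Fin 2 → ℝ := fun u x =>
  if u = 0 then
    (if x = (0, 0) then (0.749 : ℝ) ^ 2
     else if x = (1, 1) then 0
     else (0.749 : ℝ) * 0.251) / (1 - (0.251 : ℝ) ^ 2)
  else if x = (1, 1) then 1 else 0

/-- The function `a(u,x)` used in the dual `R₀` bound. -/
noncomputable def aR0 : Fin 2 → Fin 2 × Fin 2 → ℝ := fun u x =>
  if u = 0 then
    (if x = (0, 0) then 0.7186926
     else if x = (1, 1) then 0
     else -0.0488036)
  else if x = (1, 1) then -0.6210855 else 0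

/-- Upper bound for `Real.exp x`: split off the integer powers `e ^ k / e ^ m` and use the Taylor
polynomial of degree `13` with remainder on the part of the exponent in `[0, 1]`. -/
theorem exp_le_of_taylor {x B : ℝ} (k m : ℕ) (h0 : 0 ≤ x + m - k) (h1 : x + m - k ≤ 1)
    (hB : ((∑ i ∈ Finset.range 14, (x + m - k) ^ i / i.factorial) +
      (x + m - k) ^ 14 * ((14 : ℕ) + 1) / ((14 : ℕ).factorial * (14 : ℕ))) * 2.7182818286 ^ k
        ≤ B * 2.7182818283 ^ m) : Real.exp x ≤ B := by
  have hpoly := Real.exp_bound' h0 h1 (n := 14) (by norm_num)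
  have hk : Real.exp 1 ^ k ≤ 2.7182818286 ^ k :=
    pow_le_pow_left₀ (Real.exp_pos 1).le Real.exp_one_lt_d9.le k
  have hm : (2.7182818283 : ℝ) ^ m ≤ Real.exp 1 ^ m :=
    pow_le_pow_left₀ (by norm_num) Real.exp_one_gt_d9.le m
  have hmul : Real.exp x * Real.exp 1 ^ m = Real.exp (x + m - k) * Real.exp 1 ^ k := by
    rw [← Real.exp_nat_mul, ← Real.exp_nat_mul, ← Real.exp_add, ← Real.exp_add]
    congr 1
    ring
  have hle : Real.exp x * Real.exp 1 ^ m ≤ B * 2.7182818283 ^ m := by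
    rw [hmul]
    exact (mul_le_mul hpoly hk (by positivity) ((Real.exp_pos _).le.trans hpoly)).trans hB
  have hB0 : 0 ≤ B :=
    nonneg_of_mul_nonneg_left ((by positivity : (0 : ℝ) ≤ Real.exp x * Real.exp 1 ^ m).trans hle)
      (by positivity)
  exact le_of_mul_le_mul_right (hle.trans (mul_le_mul_of_nonneg_left hm hB0)) (by positivity)

/-- Lower bound for `Real.exp c` by a Taylor polynomial. -/
theorem le_exp_of_taylor {A c : ℝ} (hc : 0 ≤ c)
    (h : A ≤ ∑ i ∈ Finset.range 20, c ^ i / i.factorial) : A ≤ Real.exp c :=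
  h.trans (Real.sum_le_exp_of_nonneg hc 20)

theorem rpow_le_of_le_exp {A l r B : ℝ} (hA : 0 ≤ A) (hr : 0 ≤ r) (hl : A ≤ Real.exp l)
    (hB : Real.exp (l * r) ≤ B) : A ^ r ≤ B := by
  refine (Real.rpow_le_rpow hA hl hr).trans ?_
  rwa [← Real.exp_mul]

theorem log_one_point_three_six_le : Real.log 1.36 ≤ 0.30748469976 := by
  rw [Real.log_le_iff_le_exp (by norm_num)]
  apply le_exp_of_taylor <;> norm_num [Finset.sum_range_succ, Nat.factorial]

theorem le_log_one_point_three_six : 0.30748469973 ≤ Real.log 1.36 := by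
  rw [Real.le_log_iff_exp_le (by norm_num)]
  apply exp_le_of_taylor 0 0 <;> norm_num [Finset.sum_range_succ, Nat.factorial]

/-- Lower bounds for `Real.log (q x y)`. -/
noncomputable def logqLower : Fin 2 → Fin 3 → ℝ :=
  ![![0, 0, 0], ![0, -0.6931471808, 0.30748469973]]

/-- Upper bounds for `Real.log (q x y)`. -/
noncomputable def logqUpper : Fin 2 → Fin 3 → ℝ :=
  ![![0, 0, 0], ![0, -0.6931471803, 0.30748469976]]

/-- Upper bounds for `q x y ^ 9.3419338`. -/
noncomputable def qPowUpper : Fin 2 → Fin 3 → ℝ :=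
  ![![1, 1, 1], ![1, 0.001540982513, 17.681196139]]

/-- Upper bounds for the inner sum with `u = 0`, raised to the power `0.7587516`. -/
noncomputable def powUpper₀ : Fin 3 → Fin 3 → ℝ :=
  ![![1.435655760, 1.304677468, 3.286706323], ![1.304677468, 1.169368618, 3.187060816],
    ![3.286706323, 3.187060816, 4.837554431]]

/-- Upper bounds for the inner sum with `u = 1`, raised to the power `0.7587516`. -/
noncomputable def powUpper₁ : Fin 3 → Fin 3 → ℝ :=
  ![![0.624221744, 0.004587498179, 5.519380643],
    ![0.004587498179, 0.000033714206, 0.040562747015],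
    ![5.519380643, 0.040562747015, 48.802469680]]

/-- Upper bounds for the logarithm of the denominator of the objective. -/
noncomputable def logDenUpper : Fin 3 → Fin 3 → ℝ :=
  ![![0.325364060, 0.201119187, 1.231792340], ![0.201119187, 0.091392836, 1.094881436],
    ![1.231792340, 1.094881436, 2.029119889]]

theorem q_pos (x : Fin 2) (y : Fin 3) : 0 < q x y := by
  fin_cases x <;> fin_cases y <;> norm_num [q]

theorem q2_pos (x : Fin 2 × Fin 2) (y : Fin 3 × Fin 3) : 0 < q2 x y :=
  mul_pos (q_pos _ _) (q_pos _ _)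

theorem log_half : Real.log 0.5 = -Real.log 2 := by
  rw [← Real.log_inv]
  norm_num

theorem logqLower_le (x : Fin 2) (y : Fin 3) : logqLower x y ≤ Real.log (q x y) := by
  have h2 := Real.log_two_lt_d9
  have h136 := le_log_one_point_three_six
  fin_cases x <;> fin_cases y <;> simp [logqLower, q]
  · rw [log_half]
    linarith
  · exact h136

theorem log_q_le (x : Fin 2) (y : Fin 3) : Real.log (q x y) ≤ logqUpper x y := by
  have h2 := Real.log_two_gt_d9
  have h136 := log_one_point_three_six_le
  fin_cases x <;> fin_cases y <;> simp [logqUpper, q]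
  · rw [log_half]
    linarith
  · exact h136

theorem exp_logqUpper_le (x : Fin 2) (y : Fin 3) :
    Real.exp (9.3419338 * logqUpper x y) ≤ qPowUpper x y := by
  fin_cases x <;> fin_cases y <;> simp [logqUpper, qPowUpper]
  · apply exp_le_of_taylor 0 7 <;> norm_num [Finset.sum_range_succ, Nat.factorial]
  · apply exp_le_of_taylor 2 0 <;> norm_num [Finset.sum_range_succ, Nat.factorial]

theorem log_q2 (x : Fin 2 × Fin 2) (y : Fin 3 × Fin 3) :
    Real.log (q2 x y) = Real.log (q x.1 y.1) + Real.log (q x.2 y.2) :=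
  Real.log_mul (q_pos _ _).ne' (q_pos _ _).ne'

theorem q2_rpow_le_exp (x : Fin 2 × Fin 2) (y : Fin 3 × Fin 3) :
    q2 x y ^ (9.3419338 : ℝ) ≤
      Real.exp (9.3419338 * (logqUpper x.1 y.1 + logqUpper x.2 y.2)) := by
  rw [Real.rpow_def_of_pos (q2_pos x y), Real.exp_le_exp, log_q2]
  linarith [log_q_le x.1 y.1, log_q_le x.2 y.2]

theorem q2_rpow_le (x : Fin 2 × Fin 2) (y : Fin 3 × Fin 3) :
    q2 x y ^ (9.3419338 : ℝ) ≤ qPowUpper x.1 y.1 * qPowUpper x.2 y.2 := by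
  refine (q2_rpow_le_exp x y).trans ?_
  rw [mul_add, Real.exp_add]
  exact mul_le_mul (exp_logqUpper_le _ _) (exp_logqUpper_le _ _) (Real.exp_pos _).le
    ((Real.exp_pos _).le.trans (exp_logqUpper_le _ _))

theorem QU_pos (u : Fin 2) : 0 < QU u := by
  fin_cases u <;> norm_num [QU]

theorem QXU_nonneg (u : Fin 2) (x : Fin 2 × Fin 2) : 0 ≤ QXU u x := by
  unfold QXU
  split_ifs <;> norm_num

theorem W_nonneg (x : Fin 2) (y : Fin 3) : 0 ≤ W x y := by
  fin_cases x <;> fin_cases y <;> norm_num [W]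

/-- The inner sum over `x̄` in the denominator of the objective. -/
noncomputable def innerSum (u : Fin 2) (y : Fin 3 × Fin 3) : ℝ :=
  ∑ x : Fin 2 × Fin 2, QXU u x * q2 x y ^ (9.3419338 : ℝ) * Real.exp (aR0 u x)

theorem innerSum_nonneg (u : Fin 2) (y : Fin 3 × Fin 3) : 0 ≤ innerSum u y :=
  Finset.sum_nonneg fun x _ => mul_nonneg
    (mul_nonneg (QXU_nonneg u x) (Real.rpow_nonneg (q2_pos x y).le _)) (Real.exp_pos _).le

theorem innerSum_one (y : Fin 3 × Fin 3) :
    innerSum 1 y = q2 (1, 1) y ^ (9.3419338 : ℝ) * Real.exp (-0.6210855) := by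
  simp [innerSum, QXU, aR0]

theorem innerSum_one_pos (y : Fin 3 × Fin 3) : 0 < innerSum 1 y := by
  rw [innerSum_one]
  exact mul_pos (Real.rpow_pos_of_pos (q2_pos _ _) _) (Real.exp_pos _)

theorem innerSum_zero_le (y : Fin 3 × Fin 3) :
    innerSum 0 y ≤ (0.749 ^ 2 * 2.0517489999 +
      0.749 * 0.251 * (qPowUpper 1 y.2 + qPowUpper 1 y.1) * 0.9523681566) / (1 - 0.251 ^ 2) := by
  have he₀ : Real.exp 0.7186926 ≤ 2.0517489999 := by
    apply exp_le_of_taylor 0 0 <;> norm_num [Finset.sum_range_succ, Nat.factorial]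
  have he₁ : Real.exp (-0.0488036) ≤ 0.9523681566 := by
    apply exp_le_of_taylor 0 1 <;> norm_num [Finset.sum_range_succ, Nat.factorial]
  have hq : ∀ z, qPowUpper 0 z = 1 := by
    intro z
    fin_cases z <;> rfl
  have hprod : ∀ (x : Fin 2 × Fin 2) {e E : ℝ}, 0 ≤ e → e ≤ E →
      q2 x y ^ (9.3419338 : ℝ) * e ≤ qPowUpper x.1 y.1 * qPowUpper x.2 y.2 * E :=
    fun x _ _ h0 h => mul_le_mul (q2_rpow_le x y) h h0
      ((Real.rpow_nonneg (q2_pos x y).le _).trans (q2_rpow_le x y))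
  have h00 := hprod (0, 0) (Real.exp_pos _).le he₀
  have h01 := hprod (0, 1) (Real.exp_pos _).le he₁
  have h10 := hprod (1, 0) (Real.exp_pos _).le he₁
  simp only [hq, one_mul, mul_one] at h00 h01 h10
  have hsum : innerSum 0 y = (0.749 ^ 2 * (q2 (0, 0) y ^ (9.3419338 : ℝ) * Real.exp 0.7186926) +
      0.749 * 0.251 * (q2 (0, 1) y ^ (9.3419338 : ℝ) * Real.exp (-0.0488036) +
        q2 (1, 0) y ^ (9.3419338 : ℝ) * Real.exp (-0.0488036))) / (1 - 0.251 ^ 2) := by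
    simp [innerSum, Fintype.sum_prod_type, QXU, aR0]
    ring
  rw [hsum]
  apply div_le_div_of_nonneg_right _ (by norm_num)
  linarith

theorem innerSum_zero_rpow_le (y : Fin 3 × Fin 3) :
    innerSum 0 y ^ (0.7587516 : ℝ) ≤ powUpper₀ y.1 y.2 := by
  have key : ∀ l : ℝ, 0 ≤ l → (0.749 ^ 2 * 2.0517489999 + 0.749 * 0.251 *
      (qPowUpper 1 y.2 + qPowUpper 1 y.1) * 0.9523681566) / (1 - 0.251 ^ 2) ≤
        ∑ i ∈ Finset.range 20, l ^ i / i.factorial →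
      Real.exp (l * 0.7587516) ≤ powUpper₀ y.1 y.2 →
      innerSum 0 y ^ (0.7587516 : ℝ) ≤ powUpper₀ y.1 y.2 := fun l hl h hB =>
    rpow_le_of_le_exp (innerSum_nonneg 0 y) (by norm_num)
      ((innerSum_zero_le y).trans (le_exp_of_taylor hl h)) hB
  have h00 : Real.exp (0.4766009317 * 0.7587516) ≤ 1.435655760 := by
    apply exp_le_of_taylor 0 0 <;> norm_num [Finset.sum_range_succ, Nat.factorial]
  have h01 : Real.exp (0.3505176897 * 0.7587516) ≤ 1.304677468 := by
    apply exp_le_of_taylor 0 0 <;> norm_num [Finset.sum_range_succ, Nat.factorial]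
  have h02 : Real.exp (1.5682154015 * 0.7587516) ≤ 3.286706323 := by
    apply exp_le_of_taylor 1 0 <;> norm_num [Finset.sum_range_succ, Nat.factorial]
  have h11 : Real.exp (0.2062123609 * 0.7587516) ≤ 1.169368618 := by
    apply exp_le_of_taylor 0 0 <;> norm_num [Finset.sum_range_succ, Nat.factorial]
  have h12 : Real.exp (1.5276397669 * 0.7587516) ≤ 3.187060816 := by
    apply exp_le_of_taylor 1 0 <;> norm_num [Finset.sum_range_succ, Nat.factorial]
  have h22 : Real.exp (2.0776355659 * 0.7587516) ≤ 4.837554431 := by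
    apply exp_le_of_taylor 1 0 <;> norm_num [Finset.sum_range_succ, Nat.factorial]
  obtain ⟨y₁, y₂⟩ := y
  fin_cases y₁ <;> fin_cases y₂
  · refine key _ (by norm_num) ?_ h00
    norm_num [qPowUpper, Finset.sum_range_succ, Nat.factorial]
  · refine key _ (by norm_num) ?_ h01
    norm_num [qPowUpper, Finset.sum_range_succ, Nat.factorial]
  · refine key _ (by norm_num) ?_ h02
    norm_num [qPowUpper, Finset.sum_range_succ, Nat.factorial]
  · refine key _ (by norm_num) ?_ h01
    norm_num [qPowUpper, Finset.sum_range_succ, Nat.factorial]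
  · refine key _ (by norm_num) ?_ h11
    norm_num [qPowUpper, Finset.sum_range_succ, Nat.factorial]
  · refine key _ (by norm_num) ?_ h12
    norm_num [qPowUpper, Finset.sum_range_succ, Nat.factorial]
  · refine key _ (by norm_num) ?_ h02
    norm_num [qPowUpper, Finset.sum_range_succ, Nat.factorial]
  · refine key _ (by norm_num) ?_ h12
    norm_num [qPowUpper, Finset.sum_range_succ, Nat.factorial]
  · refine key _ (by norm_num) ?_ h22
    norm_num [qPowUpper, Finset.sum_range_succ, Nat.factorial]

theorem innerSum_one_rpow_le (y : Fin 3 × Fin 3) :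
    innerSum 1 y ^ (0.7587516 : ℝ) ≤ powUpper₁ y.1 y.2 := by
  have hexp : innerSum 1 y ≤
      Real.exp (9.3419338 * (logqUpper 1 y.1 + logqUpper 1 y.2) + -0.6210855) := by
    rw [innerSum_one, Real.exp_add]
    exact mul_le_mul_of_nonneg_right (q2_rpow_le_exp (1, 1) y) (Real.exp_pos _).le
  refine rpow_le_of_le_exp (innerSum_nonneg 1 y) (by norm_num) hexp ?_
  obtain ⟨y₁, y₂⟩ := y
  fin_cases y₁ <;> fin_cases y₂ <;> simp only [logqUpper, powUpper₁]
  · apply exp_le_of_taylor 0 1 <;> norm_num [Finset.sum_range_succ, Nat.factorial]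
  · apply exp_le_of_taylor 0 6 <;> norm_num [Finset.sum_range_succ, Nat.factorial]
  · apply exp_le_of_taylor 1 0 <;> norm_num [Finset.sum_range_succ, Nat.factorial]
  · apply exp_le_of_taylor 0 6 <;> norm_num [Finset.sum_range_succ, Nat.factorial]
  · apply exp_le_of_taylor 0 11 <;> norm_num [Finset.sum_range_succ, Nat.factorial]
  · apply exp_le_of_taylor 0 4 <;> norm_num [Finset.sum_range_succ, Nat.factorial]
  · apply exp_le_of_taylor 1 0 <;> norm_num [Finset.sum_range_succ, Nat.factorial]
  · apply exp_le_of_taylor 0 4 <;> norm_num [Finset.sum_range_succ, Nat.factorial]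
  · apply exp_le_of_taylor 3 0 <;> norm_num [Finset.sum_range_succ, Nat.factorial]

theorem denominator_pos (y : Fin 3 × Fin 3) :
    0 < ∑ u : Fin 2, QU u * innerSum u y ^ (0.7587516 : ℝ) := by
  rw [Fin.sum_univ_two]
  exact add_pos_of_nonneg_of_pos
    (mul_nonneg (QU_pos 0).le (Real.rpow_nonneg (innerSum_nonneg 0 y) _))
    (mul_pos (QU_pos 1) (Real.rpow_pos_of_pos (innerSum_one_pos y) _))

theorem log_denominator_le (y : Fin 3 × Fin 3) :
    Real.log (∑ u : Fin 2, QU u * innerSum u y ^ (0.7587516 : ℝ)) ≤ logDenUpper y.1 y.2 := by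
  rw [Real.log_le_iff_le_exp (denominator_pos y), Fin.sum_univ_two]
  refine (add_le_add (mul_le_mul_of_nonneg_left (innerSum_zero_rpow_le y) (QU_pos 0).le)
    (mul_le_mul_of_nonneg_left (innerSum_one_rpow_le y) (QU_pos 1).le)).trans ?_
  obtain ⟨y₁, y₂⟩ := y
  fin_cases y₁ <;> fin_cases y₂ <;> apply le_exp_of_taylor <;>
    norm_num [QU, powUpper₀, powUpper₁, logDenUpper, Finset.sum_range_succ, Nat.factorial]

theorem le_log_ratio (u : Fin 2) (x : Fin 2 × Fin 2) (y : Fin 3 × Fin 3) :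
    0.7587516 * (9.3419338 * (logqLower x.1 y.1 + logqLower x.2 y.2) + aR0 u x) -
        logDenUpper y.1 y.2 ≤
      Real.log ((q2 x y ^ (9.3419338 : ℝ) * Real.exp (aR0 u x)) ^ (0.7587516 : ℝ) /
        ∑ ub : Fin 2, QU ub * innerSum ub y ^ (0.7587516 : ℝ)) := by
  have hq : 0 < q2 x y ^ (9.3419338 : ℝ) := Real.rpow_pos_of_pos (q2_pos x y) _
  have hnum : 0 < q2 x y ^ (9.3419338 : ℝ) * Real.exp (aR0 u x) := mul_pos hq (Real.exp_pos _)
  rw [Real.log_div (Real.rpow_pos_of_pos hnum _).ne' (denominator_pos y).ne', Real.log_rpow hnum,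
    Real.log_mul hq.ne' (Real.exp_pos _).ne', Real.log_exp, Real.log_rpow (q2_pos x y), log_q2]
  linarith [logqLower_le x.1 y.1, logqLower_le x.2 y.2, log_denominator_le y]

/-- With `ρ₁ = 0.7587516`, `s = 9.3419338`, `R₁ = 0.2403966` and the given `a`,
the dual superposition-coding `R₀` objective for the second-order product channel
is at least `0.0356005`. -/
theorem SC_R0_dual_bound :
    (∑ u : Fin 2, ∑ x : Fin 2 × Fin 2, ∑ y : Fin 3 × Fin 3,
      QU u * QXU u x * W2 x y *
        Real.log ((q2 x y ^ (9.3419338 : ℝ) * Real.exp (aR0 u x)) ^ (0.7587516 : ℝ) /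
          (∑ ub : Fin 2, QU ub *
            (∑ xb : Fin 2 × Fin 2,
              QXU ub xb * q2 xb y ^ (9.3419338 : ℝ) * Real.exp (aR0 ub xb)) ^ (0.7587516 : ℝ))))
      - 0.7587516 * 0.2403966
    ≥ 0.0356005 := by
  have hterm : ∀ u x y, QU u * QXU u x * W2 x y *
      (0.7587516 * (9.3419338 * (logqLower x.1 y.1 + logqLower x.2 y.2) + aR0 u x) -
        logDenUpper y.1 y.2) ≤ _ := fun u x y =>
    mul_le_mul_of_nonneg_left (le_log_ratio u x y) (mul_nonneg
      (mul_nonneg (QU_pos u).le (QXU_nonneg u x)) (mul_nonneg (W_nonneg _ _) (W_nonneg _ _)))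
  have hsum := Finset.sum_le_sum fun u (_ : u ∈ Finset.univ) =>
    Finset.sum_le_sum fun x (_ : x ∈ Finset.univ) =>
      Finset.sum_le_sum fun y (_ : y ∈ Finset.univ) => hterm u x y
  refine le_trans ?_ (sub_le_sub_right hsum _)
  norm_num [Fintype.sum_prod_type, Fin.sum_univ_succ, QU, QXU, W2, W, aR0, logqLower, logDenUpper]
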